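/- arXiv:math-ph/0702072 — 2 statements merged into one kernel-verified Lean document; each statement's English description precedes it below -/
import Mathlib

section
/- Let u : ℝ × ℝ → (0,∞) be twice continuously differentiable and satisfy ∂ₜₜu(t,x) = ∂ₓ(u(t,x)^{−4/3}·∂ₓu(t,x)) for all (t,x) ∈ ℝ² (with u^{−4/3} = exp(−(4/3)·ln u)). Then for every ε ∈ ℝ, the function v(t,x) := (1+εx)^{−3}·u(t, x/(1+εx)) satisfies ∂ₜₜv(t,x) = ∂ₓ(v(t,x)^{−4/3}·∂ₓv(t,x)) for all (t,x) with 1+εx > 0. (This is the finite conformal symmetry generated by the operator x²∂_x − 3xu∂_u admitted by the equation u_tt = (u^{−4/3}u_x)_x.) -/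
/-- First-order partial derivative of `u(t,x)` with respect to `t`. -/
noncomputable def pt (u : ℝ × ℝ → ℝ) (t x : ℝ) : ℝ :=
  deriv (fun s => u (s, x)) t

/-- First-order partial derivative of `u(t,x)` with respect to `x`. -/
noncomputable def px (u : ℝ × ℝ → ℝ) (t x : ℝ) : ℝ :=
  deriv (fun y => u (t, y)) x

/-- Second-order partial derivative of `u(t,x)` with respect to `t`. -/
noncomputable def ptt (u : ℝ × ℝ → ℝ) (t x : ℝ) : ℝ :=
  deriv (fun s => pt u s x) t


/-- Derivative of the Möbius map `y ↦ y / (1 + e y)`. -/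
lemma hasDerivAt_div_one_add_mul (e y : ℝ) (hy : 0 < 1 + e * y) :
    HasDerivAt (fun y => y / (1 + e * y)) (((1 + e * y) ^ 2)⁻¹) y := by
  have hw : HasDerivAt (fun y => 1 + e * y) e y := by
    simpa using ((hasDerivAt_id y).const_mul e).const_add 1
  refine ((hasDerivAt_id y).div hw hy.ne').congr_deriv ?_
  simp only [id]
  field_simp
  ring

/-- Derivative of the conformally transformed profile. -/
lemma hasDerivAt_conformal {f : ℝ → ℝ} (hf : Differentiable ℝ f) (e y : ℝ)
    (hy : 0 < 1 + e * y) :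
    HasDerivAt (fun y => ((1 + e * y) ^ 3)⁻¹ * f (y / (1 + e * y)))
      (-3 * e * ((1 + e * y) ^ 4)⁻¹ * f (y / (1 + e * y))
        + ((1 + e * y) ^ 5)⁻¹ * deriv f (y / (1 + e * y))) y := by
  have hw : HasDerivAt (fun y => 1 + e * y) e y := by
    simpa using ((hasDerivAt_id y).const_mul e).const_add 1
  have hfz := (hf (y / (1 + e * y))).hasDerivAt.comp y (hasDerivAt_div_one_add_mul e y hy)
  refine (((hw.pow 3).inv (pow_pos hy 3).ne').mul hfz).congr_deriv ?_
  simp only [Function.comp_apply, Pi.pow_apply, Pi.inv_apply]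
  field_simp
  norm_num
  ring

/-- The flux `g ^ (-4/3) * g'` of the transformed profile, in terms of the flux of `f`. -/
lemma conformal_flux {f : ℝ → ℝ} (hf : Differentiable ℝ f) (hpos : ∀ z, 0 < f z) (e y : ℝ)
    (hy : 0 < 1 + e * y) :
    (((1 + e * y) ^ 3)⁻¹ * f (y / (1 + e * y))) ^ (-4 / 3 : ℝ)
        * deriv (fun y => ((1 + e * y) ^ 3)⁻¹ * f (y / (1 + e * y))) y
      = -3 * e * f (y / (1 + e * y)) ^ (-1 / 3 : ℝ)
        + (1 + e * y)⁻¹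
          * (f (y / (1 + e * y)) ^ (-4 / 3 : ℝ) * deriv f (y / (1 + e * y))) := by
  rw [(hasDerivAt_conformal hf e y hy).deriv]
  set z := y / (1 + e * y)
  have hw : (((1 + e * y) ^ 3)⁻¹) ^ (-4 / 3 : ℝ) = (1 + e * y) ^ 4 := by
    rw [← Real.rpow_natCast, ← Real.rpow_neg hy.le, ← Real.rpow_mul hy.le,
      ← Real.rpow_natCast]
    norm_num
  have hfz : f z ^ (-1 / 3 : ℝ) = f z ^ (-4 / 3 : ℝ) * f z := by
    rw [← Real.rpow_add_one (hpos z).ne']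
    norm_num
  rw [Real.mul_rpow (by positivity) (hpos z).le, hw, hfz]
  field_simp

/-- The flux divergence is multiplied by `(1 + e x) ^ (-3)` under the conformal
transformation. -/
lemma deriv_conformal_flux {f : ℝ → ℝ} (hf : ContDiff ℝ 2 f) (hpos : ∀ z, 0 < f z) (e x : ℝ)
    (hx : 0 < 1 + e * x) :
    deriv (fun y => (((1 + e * y) ^ 3)⁻¹ * f (y / (1 + e * y))) ^ (-4 / 3 : ℝ)
        * deriv (fun y => ((1 + e * y) ^ 3)⁻¹ * f (y / (1 + e * y))) y) x
      = ((1 + e * x) ^ 3)⁻¹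
        * deriv (fun z => f z ^ (-4 / 3 : ℝ) * deriv f z) (x / (1 + e * x)) := by
  have hfd : Differentiable ℝ f := hf.differentiable (by norm_num)
  have hf' : Differentiable ℝ (deriv f) := hf.differentiable_deriv_two
  have hflux : Differentiable ℝ (fun z => f z ^ (-4 / 3 : ℝ) * deriv f z) := fun z =>
    ((hfd z).rpow_const (Or.inl (hpos z).ne')).mul (hf' z)
  have hev : ∀ᶠ y in nhds x, 0 < 1 + e * y :=
    (by fun_prop : Continuous fun y : ℝ => 1 + e * y).continuousAt.eventually_const_lt hx
  rw [Filter.EventuallyEq.deriv_eq (hev.mono fun y hy => conformal_flux hfd hpos e y hy)]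
  have hw : HasDerivAt (fun y => 1 + e * y) e x := by
    simpa using ((hasDerivAt_id x).const_mul e).const_add 1
  have hz := hasDerivAt_div_one_add_mul e x hx
  have hroot := (((hfd (x / (1 + e * x))).hasDerivAt.comp x hz).rpow_const (p := (-1 / 3 : ℝ))
    (Or.inl (hpos _).ne')).const_mul (-3 * e)
  have hcomp := (hw.inv hx.ne').mul ((hflux (x / (1 + e * x))).hasDerivAt.comp x hz)
  refine ((hroot.add hcomp).congr_deriv ?_).deriv
  have hexp : (-1 / 3 - 1 : ℝ) = -4 / 3 := by norm_num
  simp only [Function.comp_apply, Pi.inv_apply, hexp]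
  field_simp
  ring

/-- The finite conformal symmetry generated by `x² ∂_x − 3 x u ∂_u` admitted by
the equation `u_tt = (u^{−4/3} u_x)_x`. -/
theorem conformal_symmetry_Huminus43
    (u : ℝ × ℝ → ℝ) (hu : ContDiff ℝ 2 u) (hpos : ∀ t x : ℝ, 0 < u (t, x))
    (heq : ∀ t x : ℝ,
      ptt u t x = deriv (fun y => u (t, y) ^ (-4 / 3 : ℝ) * px u t y) x)
    (e : ℝ) (v : ℝ × ℝ → ℝ)
    (hv : v = fun p => ((1 + e * p.2) ^ 3)⁻¹ * u (p.1, p.2 / (1 + e * p.2))) :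
    ∀ t x : ℝ, 0 < 1 + e * x →
      ptt v t x = deriv (fun y => v (t, y) ^ (-4 / 3 : ℝ) * px v t y) x := by
  intro t x hx
  subst hv
  have hf : ContDiff ℝ 2 fun z => u (t, z) := hu.comp (by fun_prop)
  have hflux := deriv_conformal_flux hf (hpos t) e x hx
  have htt : ptt (fun p : ℝ × ℝ => ((1 + e * p.2) ^ 3)⁻¹ * u (p.1, p.2 / (1 + e * p.2))) t x
      = ((1 + e * x) ^ 3)⁻¹ * ptt u t (x / (1 + e * x)) := by
    simp only [ptt, pt, deriv_const_mul_field]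
  rw [htt, heq]
  exact hflux.symm
end

section
/- Let f, H : ℝ → ℝ with f continuously differentiable and H continuously differentiable, let P : ℝ → ℝ satisfy P' = H, and let u : ℝ × ℝ → ℝ be twice continuously differentiable and satisfy f(x)·∂ₜₜu = ∂ₓ(H(u)·∂ₓu) on ℝ² (the case K = 0). Then the following two divergence identities hold at every (t,x) ∈ ℝ²: (i) ∂ₜ( x·f(x)·∂ₜu(t,x) ) − ∂ₓ( x·H(u(t,x))·∂ₓu(t,x) − P(u(t,x)) ) = 0; and (ii) ∂ₜ( x·f(x)·(t·∂ₜu(t,x) − u(t,x)) ) − ∂ₓ( t·( x·H(u(t,x))·∂ₓu(t,x) − P(u(t,x)) ) ) = 0. (These are the additional conservation laws CL³ and CL⁴ of the case K = 0, with conserved densities x·f·u_t and x·f·(t·u_t − u).) -/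
/-- The slices `t ↦ u(t,x)` of a `C²` function have derivative `pt u`. -/
lemma hasDerivAt_pt {u : ℝ × ℝ → ℝ} (hu : ContDiff ℝ 2 u) (t x : ℝ) :
    HasDerivAt (fun s => u (s, x)) (pt u t x) t := by
  have h : ContDiff ℝ 2 (fun s => u (s, x)) := by fun_prop
  exact (h.differentiable (by norm_num) t).hasDerivAt

/-- The slices `x ↦ u(t,x)` of a `C²` function have derivative `px u`. -/
lemma hasDerivAt_px {u : ℝ × ℝ → ℝ} (hu : ContDiff ℝ 2 u) (t x : ℝ) :
    HasDerivAt (fun y => u (t, y)) (px u t x) x := by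
  have h : ContDiff ℝ 2 (fun y => u (t, y)) := by fun_prop
  exact (h.differentiable (by norm_num) x).hasDerivAt

/-- The slices `t ↦ pt u t x` of a `C²` function have derivative `ptt u`. -/
lemma hasDerivAt_ptt {u : ℝ × ℝ → ℝ} (hu : ContDiff ℝ 2 u) (t x : ℝ) :
    HasDerivAt (fun s => pt u s x) (ptt u t x) t := by
  have h : ContDiff ℝ 2 (fun s => u (s, x)) := by fun_prop
  exact (h.differentiable_deriv_two t).hasDerivAt

lemma differentiable_px {u : ℝ × ℝ → ℝ} (hu : ContDiff ℝ 2 u) (t : ℝ) :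
    Differentiable ℝ (fun y => px u t y) := by
  have h : ContDiff ℝ 2 (fun y => u (t, y)) := by fun_prop
  exact h.differentiable_deriv_two

/-- The additional conservation laws CL³ and CL⁴ of the case `K = 0`, with
conserved densities `x·f·u_t` and `x·f·(t·u_t − u)`, where `P' = H`. -/
theorem conservation_laws_CL3_CL4
    (f H P : ℝ → ℝ) (hf : ContDiff ℝ 1 f) (hH : ContDiff ℝ 1 H)
    (hP : ∀ s : ℝ, HasDerivAt P (H s) s)
    (u : ℝ × ℝ → ℝ) (hu : ContDiff ℝ 2 u)
    (heq : ∀ t x : ℝ,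
      f x * ptt u t x = deriv (fun y => H (u (t, y)) * px u t y) x) :
    ∀ t x : ℝ,
      (deriv (fun s => x * f x * pt u s x) t
        - deriv (fun y => y * H (u (t, y)) * px u t y - P (u (t, y))) x = 0)
      ∧ (deriv (fun s => x * f x * (s * pt u s x - u (s, x))) t
        - deriv (fun y => t * (y * H (u (t, y)) * px u t y - P (u (t, y)))) x = 0) := by
  intro t x
  have hflux : HasDerivAt (fun y => H (u (t, y)) * px u t y) (f x * ptt u t x) x := by
    rw [heq t x]
    exact (((hH.differentiable one_ne_zero _).comp x
      (hasDerivAt_px hu t x).differentiableAt).mul (differentiable_px hu t x)).hasDerivAt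
  have hX : HasDerivAt (fun y => y * H (u (t, y)) * px u t y - P (u (t, y)))
      (x * f x * ptt u t x) x := by
    have h := ((hasDerivAt_id' x).mul hflux).sub ((hP _).comp x (hasDerivAt_px hu t x))
    refine (h.congr_deriv (by ring)).congr_of_eventuallyEq (.of_forall fun y => ?_)
    simp [mul_assoc]
  have hT := (hasDerivAt_ptt hu t x).const_mul (x * f x)
  have hT' := ((((hasDerivAt_id' t).mul (hasDerivAt_ptt hu t x)).sub
    (hasDerivAt_pt hu t x)).const_mul (x * f x)).deriv
  refine ⟨by rw [hT.deriv, hX.deriv, sub_self], ?_⟩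
  rw [(hX.const_mul t).deriv]
  refine (congrArg (· - _) hT').trans ?_
  ring
end
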